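/- For every integer k with 2 ≤ k and 2k ≤ n, every sign ε ∈ {1,−1}, and every b ∈ B, the following are equivalent: (i) trace(X_{k,ε}·b⁻¹·Z·b) = trace(X_{k,ε}·Z) for all Z ∈ 𝔟; (ii) b·X_{k,ε}·b⁻¹ = X_{k,ε}. In other words, the stabilizer in B of the restriction to 𝔟 of the trace form against X_{k,ε} coincides with the stabilizer of X_{k,ε} in B. -/

import Mathlib

open Matrix

/-- The n×n real matrix unit `E_{a,b}` (1-based indices). -/
noncomputable def Ematrix (n a b : ℕ) : Matrix (Fin n) (Fin n) ℝ :=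
  fun s t => if (s : ℕ) + 1 = a ∧ (t : ℕ) + 1 = b then 1 else 0

/-- `X_{k,ε} = Σ_{i=1}^{k−1} E_{n+1−i,i} + ε·E_{n+1−k,k}`. -/
noncomputable def Xmat (n k : ℕ) (ε : ℝ) : Matrix (Fin n) (Fin n) ℝ :=
  (∑ i ∈ Finset.Icc 1 (k - 1), Ematrix n (n + 1 - i) i) + ε • Ematrix n (n + 1 - k) k

/-- The Borel subalgebra `𝔟` of upper-triangular traceless real n×n matrices, as a set. -/
def borelSet (n : ℕ) : Set (Matrix (Fin n) (Fin n) ℝ) :=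
  {Y | Y.trace = 0 ∧ ∀ s t : Fin n, (t : ℕ) < (s : ℕ) → Y s t = 0}

/-- The coefficient of `Xmat n k ε` in (0-based) column `t`. -/
noncomputable def antidiagCoeff (k : ℕ) (ε : ℝ) (t : ℕ) : ℝ :=
  if t + 1 < k then 1 else if t + 1 = k then ε else 0

theorem antidiagCoeff_of_le {k t : ℕ} (ε : ℝ) (h : k ≤ t) : antidiagCoeff k ε t = 0 := by
  rw [antidiagCoeff, if_neg (by omega), if_neg (by omega)]

theorem antidiagCoeff_ne_zero {k t : ℕ} {ε : ℝ} (hε : ε ≠ 0) (h : t < k) :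
    antidiagCoeff k ε t ≠ 0 := by
  unfold antidiagCoeff
  split_ifs
  · exact one_ne_zero
  · exact hε
  · omega

theorem Xmat_apply {n k : ℕ} (hk : 1 ≤ k) (ε : ℝ) (s t : Fin n) :
    Xmat n k ε s t = if s = t.rev then antidiagCoeff k ε t else 0 := by
  have hs := s.isLt
  have ht := t.isLt
  have hrev : s = t.rev ↔ (s : ℕ) + t + 1 = n := by
    rw [Fin.ext_iff, Fin.val_rev]
    omega
  have hsum : (∑ i ∈ Finset.Icc 1 (k - 1), Ematrix n (n + 1 - i) i) s t =
      ∑ i ∈ Finset.Icc 1 (k - 1),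
        if (t : ℕ) + 1 = i then (if (s : ℕ) + t + 1 = n then (1 : ℝ) else 0) else 0 := by
    rw [Matrix.sum_apply]
    refine Finset.sum_congr rfl fun i _ => ?_
    unfold Ematrix
    split_ifs <;> first | rfl | omega
  rw [Xmat, Matrix.add_apply, hsum, Finset.sum_ite_eq, Matrix.smul_apply]
  simp only [Ematrix, antidiagCoeff, hrev, Finset.mem_Icc, smul_eq_mul]
  split_ifs <;> first | omega | simp

theorem mul_Xmat_apply {n k : ℕ} (hk : 1 ≤ k) (ε : ℝ) (b : Matrix (Fin n) (Fin n) ℝ)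
    (s t : Fin n) : (b * Xmat n k ε) s t = b s t.rev * antidiagCoeff k ε t := by
  simp [Matrix.mul_apply, Xmat_apply hk]

theorem Xmat_mul_apply {n k : ℕ} (hk : 1 ≤ k) (ε : ℝ) (b : Matrix (Fin n) (Fin n) ℝ)
    (s t : Fin n) :
    (Xmat n k ε * b) s t = antidiagCoeff k ε s.rev * b s.rev t := by
  rw [Matrix.mul_apply, Finset.sum_eq_single s.rev]
  · simp [Xmat_apply hk]
  · intro u _ hu
    rw [Xmat_apply hk, if_neg (fun h => hu (by rw [h, Fin.rev_rev])), zero_mul]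
  · simp

/-- A traceless matrix orthogonal to the Borel subalgebra under the trace form is strictly upper
triangular. -/
theorem apply_eq_zero_of_trace_mul_borelSet {n : ℕ} {M : Matrix (Fin n) (Fin n) ℝ}
    (htr : M.trace = 0) (h : ∀ Z ∈ borelSet n, (M * Z).trace = 0) {s t : Fin n} (hst : t ≤ s) :
    M s t = 0 := by
  rcases hst.eq_or_lt with rfl | hlt
  · have hdiag : ∀ u, M u u = M t t := by
      intro u
      have := h (single u u 1 - single t t 1) ⟨by simp, fun a c hac => by
        have hne : a ≠ c := fun e => by simp [e] at hac
        have hu : ∀ v : Fin n, (single v v (1 : ℝ)) a c = 0 := fun v =>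
          single_apply_of_ne _ _ _ _ _ fun e => hne (e.1.symm.trans e.2)
        simp [hu]⟩
      rw [mul_sub, trace_sub, trace_mul_single, trace_mul_single] at this
      simpa [sub_eq_zero] using this
    have hn : (n : ℝ) ≠ 0 := Nat.cast_ne_zero.2 (Nat.ne_zero_of_lt t.isLt)
    simpa [Matrix.trace, hdiag, hn] using htr
  · have := h (single t s 1) ⟨trace_single_eq_of_ne _ _ _ hlt.ne, fun a c hac =>
      single_apply_of_ne _ _ _ _ _ fun e => by
        obtain ⟨rfl, rfl⟩ := e
        exact absurd hlt (by simpa using hac.le)⟩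
    simpa [trace_mul_single] using this

/-- If an upper triangular `b` commutes with `Xmat n k ε` on and below the diagonal, then it
commutes with it. -/
theorem commute_Xmat_of_lower {n k : ℕ} (hk : 1 ≤ k) (hkn : 2 * k ≤ n) {ε : ℝ} (hε : ε ≠ 0)
    {b : Matrix (Fin n) (Fin n) ℝ} (hb : ∀ s t : Fin n, t < s → b s t = 0)
    (h : ∀ s t : Fin n, t ≤ s → (b * Xmat n k ε) s t = (Xmat n k ε * b) s t) :
    b * Xmat n k ε = Xmat n k ε * b := by
  simp only [mul_Xmat_apply hk, Xmat_mul_apply hk] at h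
  have hcol : ∀ s t : Fin n, (t : ℕ) < k → t ≤ s → s < t.rev → b s t.rev = 0 := by
    intro s t htk hts hst
    have := h s t hts
    rw [hb s.rev t (Fin.lt_rev_iff.1 hst), mul_zero] at this
    exact (mul_eq_zero.1 this).resolve_right (antidiagCoeff_ne_zero hε htk)
  have hrow : ∀ j t : Fin n, (j : ℕ) < k → j < t → t ≤ j.rev → b j t = 0 := by
    intro j t hjk hjt htj
    have := h j.rev t htj
    rw [hb j.rev t.rev (Fin.rev_lt_rev.2 hjt), zero_mul, Fin.rev_rev] at this
    exact (mul_eq_zero.1 this.symm).resolve_left (antidiagCoeff_ne_zero hε hjk)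
  ext s t
  rw [mul_Xmat_apply hk, Xmat_mul_apply hk]
  rcases le_or_gt t s with hts | hst
  · exact h s t hts
  have hs := s.isLt
  have ht := t.isLt
  have hst' : (s : ℕ) < t := hst
  have hleft : b s t.rev * antidiagCoeff k ε t = 0 := by
    rcases lt_or_ge (t : ℕ) k with htk | htk
    · rw [hrow s t.rev (by omega) (by rw [Fin.lt_def, Fin.val_rev]; omega)
        (Fin.rev_le_rev.2 hst.le), zero_mul]
    · rw [antidiagCoeff_of_le ε htk, mul_zero]
  have hright : antidiagCoeff k ε s.rev * b s.rev t = 0 := by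
    rcases lt_or_ge (s.rev : ℕ) k with hsk | hsk
    · rw [Fin.val_rev] at hsk
      have := hcol s.rev t.rev (by rw [Fin.val_rev]; omega) (Fin.rev_le_rev.2 hst.le)
        (by rw [Fin.rev_rev, Fin.lt_def, Fin.val_rev]; omega)
      rw [Fin.rev_rev] at this
      rw [this, mul_zero]
    · rw [antidiagCoeff_of_le ε hsk, zero_mul]
  rw [hleft, hright]

theorem B_form_stabilizer_iff_stabilizer (n : ℕ) (hn : 4 ≤ n) (k : ℕ)
    (hk : 2 ≤ k) (hkn : 2 * k ≤ n) (ε : ℝ) (hε : ε = 1 ∨ ε = -1)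
    (b : Matrix.SpecialLinearGroup (Fin n) ℝ)
    (hb : ∀ s t : Fin n, (t : ℕ) < (s : ℕ) → b.val s t = 0) :
    (∀ Z ∈ borelSet n,
        (Xmat n k ε * ((b⁻¹).val * Z * b.val)).trace = (Xmat n k ε * Z).trace) ↔
      b.val * Xmat n k ε * (b⁻¹).val = Xmat n k ε := by
  have hk1 : 1 ≤ k := by omega
  have hε0 : ε ≠ 0 := by rcases hε with rfl | rfl <;> norm_num
  have hb' : ∀ s t : Fin n, t < s → b.val s t = 0 := fun s t hst => hb s t hst
  have hinv : (b⁻¹).val * b.val = 1 := congrArg Subtype.val (inv_mul_cancel b)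
  have hinv' : b.val * (b⁻¹).val = 1 := congrArg Subtype.val (mul_inv_cancel b)
  set X := Xmat n k ε with hX
  set c := (b⁻¹).val
  have hcyc : ∀ Z, (X * (c * Z * b.val)).trace = (b.val * X * c * Z).trace := by
    intro Z
    rw [← mul_assoc, trace_mul_comm, ← mul_assoc, ← mul_assoc]
  constructor
  · intro h
    set N := b.val * X * c - X with hN
    have htr : N.trace = 0 := by
      rw [hN, trace_sub, trace_mul_comm, ← mul_assoc, hinv, one_mul, sub_self]
    have hNlow : ∀ s t : Fin n, t ≤ s → N s t = 0 := fun s t hst =>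
      apply_eq_zero_of_trace_mul_borelSet htr
        (fun Z hZ => by rw [hN, sub_mul, trace_sub, ← hcyc, h Z hZ, sub_self]) hst
    have hNb : b.val * X = X * b.val + N * b.val := by
      rw [hN, sub_mul, mul_assoc (b.val * X), hinv, mul_one, add_sub_cancel]
    have hcomm : b.val * X = X * b.val := by
      refine commute_Xmat_of_lower hk1 hkn hε0 hb' fun s t hts => ?_
      rw [← hX, hNb, Matrix.add_apply, add_eq_left, Matrix.mul_apply]
      refine Finset.sum_eq_zero fun u _ => ?_
      rcases le_or_gt u s with hus | hsu
      · rw [hNlow s u hus, zero_mul]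
      · rw [hb' u t (hts.trans_lt hsu), mul_zero]
    rw [hcomm, mul_assoc, hinv', mul_one]
  · intro h Z _
    rw [hcyc, h]
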